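/- Let G be a finite directed graph with a rooted spanning tree T and an injective visit numbering ν satisfying the interval property and the cross-edge property, and let H be a subgraph of G. Let a be a vertex of G and let S be a strongly connected component of H that contains at least one descendant of a in T. If S contains no proper ancestor of a in T, then every vertex of S is a descendant of a in T, i.e., S ⊆ T(a). -/

import Mathlib

/-- `v` is reachable from `u` in the directed graph with edge set `E`
(via a directed path, possibly of length 0). -/
def DReach {V : Type*} (E : Set (V × V)) (u v : V) : Prop :=
  Relation.ReflTransGen (fun a b => (a, b) ∈ E) u v

/-- `u` and `v` are strongly connected in the directed graph with edge set `E`. -/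
def DSConn {V : Type*} (E : Set (V × V)) (u v : V) : Prop :=
  DReach E u v ∧ DReach E v u

/-- In a rooted tree given by a `parent` function, `a` is an ancestor of `b`
(reflexively: every vertex is its own ancestor) if following the parent
pointers from `b` eventually reaches `a`. -/
def IsTAncestor {V : Type*} (parent : V → V) (a b : V) : Prop :=
  Relation.ReflTransGen (fun x y => y = parent x) b a

/-- A property preserved by every edge inside a strongly connected component spreads from one
vertex of the component to all of its vertices. -/
theorem DSConn.invariant {V : Type*} {H : Set (V × V)} {w₀ : V} {P : V → Prop}
    (hP : ∀ x y, DSConn H x w₀ → DSConn H y w₀ → (x, y) ∈ H → P x → P y)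
    {u w : V} (hu : DSConn H u w₀) (hw : DSConn H w w₀) (h : P u) : P w := by
  have key : ∀ z, DReach H u z → DReach H z w₀ → P z := by
    intro z hz
    induction hz with
    | refl => exact fun _ => h
    | @tail b c hub hbc ih =>
      intro hc
      have hb : DReach H b w₀ := Relation.ReflTransGen.head hbc hc
      have huc : DReach H u c := Relation.ReflTransGen.tail hub hbc
      exact hP b c ⟨hb, hu.2.trans hub⟩ ⟨hc, hu.2.trans huc⟩ hbc (ih hb)
  exact key w (hu.1.trans hw.2) hw.1

/-- Lemma 9 of the paper. Let `G` be a finite directed graph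
with a rooted spanning tree `T` (given by `parent`/`root`) and an injective
visit numbering `ν` satisfying the interval property and the cross-edge
property, and let `H` be a subgraph of `G`.  Let `a` be a vertex and `S` a
strongly connected component of `H` containing at least one descendant of `a`
in `T`.  If `S` contains no proper ancestor of `a`, then `S ⊆ T(a)`, i.e. every
vertex of `S` is a descendant of `a`. -/
theorem scc_contained_in_subtree {V : Type*} [Fintype V]
    (E H : Set (V × V)) (hHE : H ⊆ E)
    (parent : V → V) (root : V)
    (hroot : parent root = root)
    (hspan : ∀ v : V, IsTAncestor parent root v)
    (htreeEdge : ∀ v : V, v ≠ root → (parent v, v) ∈ E)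
    (ν : V → ℕ) (hν : Function.Injective ν)
    (hinterval : ∀ v u : V, IsTAncestor parent v u ↔
      (ν v ≤ ν u ∧ ν u < ν v + Set.ncard {w | IsTAncestor parent v w}))
    (hcross : ∀ x y : V, (x, y) ∈ E →
      ¬ IsTAncestor parent x y → ¬ IsTAncestor parent y x → ν y < ν x)
    (a : V) (S : Set V) (w₀ : V) (hS : S = {u | DSConn H u w₀})
    (hinter : ∃ u ∈ S, IsTAncestor parent a u)
    (hnoanc : ¬ ∃ u ∈ S, u ≠ a ∧ IsTAncestor parent u a) :
    S ⊆ {u | IsTAncestor parent a u} := by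
  subst hS
  obtain ⟨u, hu, hau⟩ := hinter
  have hno : ∀ x, DSConn H x w₀ → IsTAncestor parent x a → x = a := by
    intro x hx hxa
    by_contra hne
    exact hnoanc ⟨x, hx, hne, hxa⟩
  have hlow : ∀ x y, DSConn H x w₀ → DSConn H y w₀ → (x, y) ∈ H → ν x < ν a → ν y < ν a := by
    intro x y hx _ hxy hlt
    by_contra! hge
    have hyx : ¬ IsTAncestor parent y x := by
      rw [hinterval]
      omega
    have hxy' : IsTAncestor parent x y := by
      by_contra hxy'
      have := hcross x y (hHE hxy) hxy' hyx
      omega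
    rw [hinterval] at hxy'
    have hxa : IsTAncestor parent x a := by
      rw [hinterval]
      omega
    rw [hno x hx hxa] at hlt
    exact lt_irrefl _ hlt
  have hstep : ∀ x y, DSConn H x w₀ → DSConn H y w₀ → (x, y) ∈ H →
      (IsTAncestor parent a x ∨ ν x < ν a) → (IsTAncestor parent a y ∨ ν y < ν a) := by
    rintro x y hx hy hxy (hax | hlt)
    · by_contra! hcon
      obtain ⟨hay, hge⟩ := hcon
      have hnxy : ¬ IsTAncestor parent x y := fun h => hay (h.trans hax)
      have hnyx : ¬ IsTAncestor parent y x := by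
        intro hyx
        rw [hinterval] at hax hay hyx
        omega
      have hlt := hcross x y (hHE hxy) hnxy hnyx
      rw [hinterval] at hax hay
      omega
    · exact Or.inr (hlow x y hx hy hxy hlt)
  intro w hw
  rcases DSConn.invariant hstep hu hw (Or.inl hau) with haw | hlt
  · exact haw
  · have hlt' : ν u < ν a := DSConn.invariant hlow hw hu hlt
    have hle := ((hinterval a u).1 hau).1
    omega
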